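/- Let a be a cap, with renormalization points ξ = ξ(a), ξ* = ξ(a*), and assume the renormalized measures ν_a = (d_{ξ})_* μ_a and ν_{a*} = (d_{ξ*})_* μ_{a*} are simple, with unique maximal directions [s(a)], [s(a*)] ∈ RP^n. Then the map R_a = d_{ξ*} ∘ τ_a ∘ d_{−ξ} is an orthogonal transformation of R^{n+1} and [s(a*)] = R_a [s(a)]. -/

import Mathlib

open MeasureTheory Metric Real Filter Set
open scoped RealInnerProductSpace ENNReal NNReal Topology Classical

noncomputable section

/-- Ambient Euclidean space `ℝ^{n+1}`. -/
abbrev Eu (n : ℕ) : Type := EuclideanSpace ℝ (Fin (n + 1))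

/-- The unit sphere `S^n ⊆ ℝ^{n+1}` as a subset of the ambient space. -/
def sphSet (n : ℕ) : Set (Eu n) := Metric.sphere (0 : Eu n) 1

/-- The canonical (round) volume measure of `S^n`, viewed as a measure on the
ambient space `ℝ^{n+1}` supported on the unit sphere. -/
def sphMeasure (n : ℕ) : Measure (Eu n) :=
  Measure.map Subtype.val ((volume : Measure (Eu n)).toSphere)

/-- `σ_n`, the volume of the round unit `n`-sphere. -/
def sigmaVol (n : ℕ) : ℝ := (sphMeasure n Set.univ).toReal

/-- The constant `K_n`. -/
def Kconst (n : ℕ) : ℝ :=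
  ((n + 1 : ℝ) / n) *
    ((Real.Gamma n * Real.Gamma ((n + 1) / 2)) /
      (Real.Gamma (n + 1 / 2) * Real.Gamma (n / 2))) ^ ((2 : ℝ) / n)

/-- The linear coordinate function `X_s(x) = s · x`. -/
def Xfun {n : ℕ} (s x : Eu n) : ℝ := ⟪s, x⟫

/-- The tangential gradient on the sphere of (the restriction of) an ambient function:
`∇_{S^n} f (x) = ∇f(x) - ⟨∇f(x), x⟩ x`. -/
def gradS {n : ℕ} (f : Eu n → ℝ) (x : Eu n) : Eu n :=
  gradient f x - ⟪gradient f x, x⟫ • x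

/-- A conformal factor `w` represents the metric `g = w² g₀` on `S^n`; it is admissible if it
is smooth and positive on the sphere. -/
def IsConformalFactor (n : ℕ) (w : Eu n → ℝ) : Prop :=
  ContDiff ℝ (⊤ : ℕ∞) w ∧ ∀ x ∈ sphSet n, 0 < w x

/-- The Riemannian measure `dv_g` of the conformal metric `g = w² g₀`, i.e. `w^n dv_{g₀}`. -/
def confMeasure (n : ℕ) (w : Eu n → ℝ) : Measure (Eu n) :=
  (sphMeasure n).withDensity fun x => ENNReal.ofReal (w x ^ n)

/-- The volume of `(S^n, g)`, `g = w² g₀`. -/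
def confVol (n : ℕ) (w : Eu n → ℝ) : ℝ := (confMeasure n w Set.univ).toReal

/-- The Dirichlet energy `∫ |∇_g u|²_g dv_g` of the restriction to `S^n` of `V`,
for `g = w² g₀`: it equals `∫ w^{n-2} |∇_{g₀} V|²_{g₀} dv_{g₀}`. -/
def dirichlet (n : ℕ) (w : Eu n → ℝ) (V : Eu n → ℝ) : ℝ :=
  ∫ x, w x ^ (n - 2) * ‖gradS V x‖ ^ 2 ∂(sphMeasure n)

/-- `∫ u² dv_g`. -/
def l2sq (n : ℕ) (w : Eu n → ℝ) (V : Eu n → ℝ) : ℝ :=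
  ∫ x, (V x) ^ 2 ∂(confMeasure n w)

/-- Mean value zero w.r.t. `dv_g`. -/
def MeanZero (n : ℕ) (w : Eu n → ℝ) (V : Eu n → ℝ) : Prop :=
  ∫ x, V x ∂(confMeasure n w) = 0

/-- The second nonzero eigenvalue `λ₂(S^n, g)` of the Laplace–Beltrami operator of
`g = w² g₀`, defined via the Courant–Fischer min-max characterization over two-dimensional
spaces of mean-zero test functions (restrictions of smooth ambient functions). -/
def lambda2 (n : ℕ) (w : Eu n → ℝ) : ℝ :=
  sInf { Λ : ℝ | ∃ V W : Eu n → ℝ, ContDiff ℝ (⊤ : ℕ∞) V ∧ ContDiff ℝ (⊤ : ℕ∞) W ∧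
    MeanZero n w V ∧ MeanZero n w W ∧
    (∀ a b : ℝ, (∀ x ∈ sphSet n, a * V x + b * W x = 0) → a = 0 ∧ b = 0) ∧
    Λ = sSup { q : ℝ | ∃ a b : ℝ, ¬(a = 0 ∧ b = 0) ∧
      q = dirichlet n w (fun x => a * V x + b * W x) /
          l2sq n w (fun x => a * V x + b * W x) } }

/-- The conformal transformation `d_ξ` of the closed unit ball. -/
def dMap {n : ℕ} (ξ : Eu n) (x : Eu n) : Eu n :=
  (1 + 2 * ⟪ξ, x⟫ + ‖x‖ ^ 2 * ‖ξ‖ ^ 2)⁻¹ •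
    ((1 - ‖ξ‖ ^ 2) • x + (1 + 2 * ⟪ξ, x⟫ + ‖x‖ ^ 2) • ξ)

/-- The reflection `R_p(x) = x - 2(p·x)p`. -/
def Refl {n : ℕ} (p x : Eu n) : Eu n := x - (2 * ⟪p, x⟫) • p

/-- The spherical cap `a_{r,p} = d_{rp}(a_{0,p})`. -/
def cap (n : ℕ) (r : ℝ) (p : Eu n) : Set (Eu n) :=
  dMap (r • p) '' {x ∈ sphSet n | 0 < ⟪p, x⟫}

/-- The conformal reflection `τ_{a_{r,p}} = d_{rp} ∘ R_p ∘ d_{-rp}`. -/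
def tauMap {n : ℕ} (r : ℝ) (p : Eu n) : Eu n → Eu n :=
  dMap (r • p) ∘ Refl p ∘ dMap (-(r • p))

/-- The measure `μ_{a_{r,p}}`, equal to `dv_g + (τ_a)^* dv_g` on `a` and `0` on `a^*`. -/
def capMeasure (n : ℕ) (w : Eu n → ℝ) (r : ℝ) (p : Eu n) : Measure (Eu n) :=
  (confMeasure n w + Measure.map (tauMap r p) (confMeasure n w)).restrict (cap n r p)

/-- `d_ξ` renormalizes the finite measure `μ`: `∫ X_s ∘ d_ξ dμ = 0` for all `s ∈ S^n`. -/
def Renormalizes {n : ℕ} (ξ : Eu n) (μ : Measure (Eu n)) : Prop :=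
  ∀ s ∈ sphSet n, ∫ x, Xfun s (dMap ξ x) ∂μ = 0

/-- The quadratic form `Q(s) = ∫ X_s² dν` of a measure `ν`. -/
def Qform {n : ℕ} (ν : Measure (Eu n)) (s : Eu n) : ℝ := ∫ x, (⟪s, x⟫ : ℝ) ^ 2 ∂ν

/-- The maximal eigenvalue of the quadratic form `Q`. -/
def maxEig (n : ℕ) (ν : Measure (Eu n)) : ℝ :=
  sSup { q : ℝ | ∃ s : Eu n, ‖s‖ = 1 ∧ q = Qform ν s }

/-- `ν` is simple with (unit) maximal direction `s₀`: the eigenspace of the maximal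
eigenvalue of `Q` is the line spanned by `s₀`. -/
def IsMaxDir {n : ℕ} (ν : Measure (Eu n)) (s₀ : Eu n) : Prop :=
  ‖s₀‖ = 1 ∧ ∀ s : Eu n, Qform ν s = maxEig n ν * ‖s‖ ^ 2 ↔ ∃ c : ℝ, s = c • s₀

/-- `ν` is multiple: the eigenspace of the maximal eigenvalue of `Q` has dimension ≥ 2. -/
def IsMultiple {n : ℕ} (ν : Measure (Eu n)) : Prop :=
  ∃ s t : Eu n, Qform ν s = maxEig n ν * ‖s‖ ^ 2 ∧ Qform ν t = maxEig n ν * ‖t‖ ^ 2 ∧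
    LinearIndependent ℝ ![s, t]

/-- The test function `u_a^s` (for `a = a_{r,p}` with renormalization point `ξ`):
`X_s ∘ d_ξ` on `a` and `X_s ∘ d_ξ ∘ τ_a` on `a^*`. -/
def testFun (n : ℕ) (ξ : Eu n) (r : ℝ) (p : Eu n) (s : Eu n) (x : Eu n) : ℝ :=
  if 0 < ⟪p, dMap (-(r • p)) x⟫ then Xfun s (dMap ξ x) else Xfun s (dMap ξ (tauMap r p x))

/-- The first coordinate vector `e₁ ∈ ℝ^{n+1}`. -/
def e1 (n : ℕ) : Eu n := EuclideanSpace.single 0 1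

section MoebiusMaps

variable {n : ℕ}

/-- A map acts conformally on the closed unit ball if it has a positive conformal factor there
which governs both chordal distances and the distance to the unit sphere. -/
def IsBallConformal (f : Eu n → Eu n) : Prop :=
  ∃ l : Eu n → ℝ, (∀ x, ‖x‖ ≤ 1 → 0 < l x ∧ 1 - ‖f x‖ ^ 2 = l x * (1 - ‖x‖ ^ 2)) ∧
    ∀ x y, ‖x‖ ≤ 1 → ‖y‖ ≤ 1 → ‖f x - f y‖ ^ 2 = l x * l y * ‖x - y‖ ^ 2

lemma IsBallConformal.norm_le {f : Eu n → Eu n} (hf : IsBallConformal f) {x : Eu n}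
    (hx : ‖x‖ ≤ 1) : ‖f x‖ ≤ 1 := by
  obtain ⟨l, h1, -⟩ := hf
  obtain ⟨h2, h3⟩ := h1 x hx
  have : 0 ≤ l x * (1 - ‖x‖ ^ 2) := mul_nonneg h2.le (by nlinarith [norm_nonneg x])
  nlinarith [norm_nonneg (f x)]

lemma IsBallConformal.norm_lt {f : Eu n → Eu n} (hf : IsBallConformal f) {x : Eu n}
    (hx : ‖x‖ < 1) : ‖f x‖ < 1 := by
  obtain ⟨l, h1, -⟩ := hf
  obtain ⟨h2, h3⟩ := h1 x hx.le
  have : 0 < l x * (1 - ‖x‖ ^ 2) := mul_pos h2 (by nlinarith [norm_nonneg x])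
  nlinarith [norm_nonneg (f x)]

lemma IsBallConformal.norm_eq_one {f : Eu n → Eu n} (hf : IsBallConformal f) {x : Eu n}
    (hx : ‖x‖ = 1) : ‖f x‖ = 1 := by
  obtain ⟨l, h1, -⟩ := hf
  obtain ⟨h2, h3⟩ := h1 x hx.le
  rw [hx] at h3
  have : (‖f x‖ - 1) * (‖f x‖ + 1) = 0 := by linarith
  rcases mul_eq_zero.1 this with h | h
  · linarith
  · linarith [norm_nonneg (f x)]

lemma IsBallConformal.comp {f g : Eu n → Eu n} (hf : IsBallConformal f)
    (hg : IsBallConformal g) : IsBallConformal (f ∘ g) := by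
  have hn : ∀ x, ‖x‖ ≤ 1 → ‖g x‖ ≤ 1 := fun x hx => hg.norm_le hx
  obtain ⟨l, h1, h2⟩ := hf
  obtain ⟨m, h3, h4⟩ := hg
  refine ⟨fun x => l (g x) * m x, fun x hx => ⟨?_, ?_⟩, fun x y hx hy => ?_⟩
  · exact mul_pos (h1 _ (hn x hx)).1 (h3 x hx).1
  · rw [Function.comp_apply, (h1 _ (hn x hx)).2, (h3 x hx).2]; ring
  · rw [Function.comp_apply, Function.comp_apply, h2 _ _ (hn x hx) (hn y hy), h4 x y hx hy]; ring

lemma dMap_denom_pos {ξ x : Eu n} (hξ : ‖ξ‖ < 1) (hx : ‖x‖ ≤ 1) :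
    0 < 1 + 2 * ⟪ξ, x⟫ + ‖x‖ ^ 2 * ‖ξ‖ ^ 2 := by
  have h1 := neg_le_of_abs_le (abs_real_inner_le_norm ξ x)
  have h2 : ‖ξ‖ * ‖x‖ < 1 := by nlinarith [norm_nonneg ξ, norm_nonneg x]
  nlinarith [sq_nonneg (1 - ‖ξ‖ * ‖x‖), sq_pos_of_pos (sub_pos.2 h2)]

lemma inner_smul_add_smul (A B C A' B' C' : ℝ) (ξ x y : Eu n) :
    ⟪C • (A • x + B • ξ), C' • (A' • y + B' • ξ)⟫ =
      C * C' * (A * A' * ⟪x, y⟫ + A * B' * ⟪ξ, x⟫ + B * A' * ⟪ξ, y⟫ + B * B' * ‖ξ‖ ^ 2) := by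
  simp only [inner_add_left, inner_add_right, real_inner_smul_left, real_inner_smul_right,
    real_inner_self_eq_norm_sq, real_inner_comm ξ x]
  ring

lemma norm_dMap_sq {ξ x : Eu n} (hξ : ‖ξ‖ < 1) (hx : ‖x‖ ≤ 1) :
    1 - ‖dMap ξ x‖ ^ 2 =
      (1 - ‖ξ‖ ^ 2) / (1 + 2 * ⟪ξ, x⟫ + ‖x‖ ^ 2 * ‖ξ‖ ^ 2) * (1 - ‖x‖ ^ 2) := by
  have hD := (dMap_denom_pos hξ hx).ne'
  rw [← real_inner_self_eq_norm_sq (dMap ξ x), dMap, inner_smul_add_smul,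
    real_inner_self_eq_norm_sq]
  field_simp
  ring

lemma isBallConformal_dMap {ξ : Eu n} (hξ : ‖ξ‖ < 1) : IsBallConformal (dMap ξ) := by
  refine ⟨fun x => (1 - ‖ξ‖ ^ 2) / (1 + 2 * ⟪ξ, x⟫ + ‖x‖ ^ 2 * ‖ξ‖ ^ 2),
    fun x hx => ⟨div_pos (by nlinarith [norm_nonneg ξ]) (dMap_denom_pos hξ hx),
      norm_dMap_sq hξ hx⟩, fun x y hx hy => ?_⟩
  have hD := (dMap_denom_pos hξ hx).ne'
  have hE := (dMap_denom_pos hξ hy).ne'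
  have hN := norm_dMap_sq hξ hx
  have hM := norm_dMap_sq hξ hy
  rw [norm_sub_sq_real, norm_sub_sq_real, eq_sub_of_add_eq' (sub_eq_iff_eq_add.1 hN).symm,
    eq_sub_of_add_eq' (sub_eq_iff_eq_add.1 hM).symm]
  simp only [dMap, inner_smul_add_smul]
  generalize (⟪x, y⟫ : ℝ) = c at *
  generalize (⟪ξ, x⟫ : ℝ) = t at *
  generalize (⟪ξ, y⟫ : ℝ) = u at *
  generalize ‖ξ‖ ^ 2 = a at *
  generalize ‖x‖ ^ 2 = b at *
  generalize ‖y‖ ^ 2 = d at *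
  rw [mul_comm b a] at hD ⊢
  rw [mul_comm d a] at hE ⊢
  field_simp
  ring

lemma dMap_neg_dMap {ξ x : Eu n} (hξ : ‖ξ‖ < 1) (hx : ‖x‖ ≤ 1) : dMap (-ξ) (dMap ξ x) = x := by
  have hD := (dMap_denom_pos hξ hx).ne'
  have ha : 1 - ‖ξ‖ ^ 2 ≠ 0 := by nlinarith [norm_nonneg ξ]
  have hN : ‖dMap ξ x‖ ^ 2 = 1 - (1 - ‖ξ‖ ^ 2) /
      (1 + 2 * ⟪ξ, x⟫ + ‖x‖ ^ 2 * ‖ξ‖ ^ 2) * (1 - ‖x‖ ^ 2) := by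
    linarith [norm_dMap_sq hξ hx]
  have hI : ⟪ξ, dMap ξ x⟫ = (1 + 2 * ⟪ξ, x⟫ + ‖x‖ ^ 2 * ‖ξ‖ ^ 2)⁻¹ *
      ((1 - ‖ξ‖ ^ 2) * ⟪ξ, x⟫ + (1 + 2 * ⟪ξ, x⟫ + ‖x‖ ^ 2) * ‖ξ‖ ^ 2) := by
    rw [dMap, real_inner_smul_right, inner_add_right, real_inner_smul_right,
      real_inner_smul_right, real_inner_self_eq_norm_sq]
  have hden : 1 + 2 * ⟪-ξ, dMap ξ x⟫ + ‖dMap ξ x‖ ^ 2 * ‖-ξ‖ ^ 2 =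
      (1 - ‖ξ‖ ^ 2) ^ 2 / (1 + 2 * ⟪ξ, x⟫ + ‖x‖ ^ 2 * ‖ξ‖ ^ 2) := by
    rw [inner_neg_left, norm_neg, hN, hI]
    field_simp
    ring
  have hnum : 1 + 2 * ⟪-ξ, dMap ξ x⟫ + ‖dMap ξ x‖ ^ 2 =
      (1 - ‖ξ‖ ^ 2) * (1 + 2 * ⟪ξ, x⟫ + ‖x‖ ^ 2) /
        (1 + 2 * ⟪ξ, x⟫ + ‖x‖ ^ 2 * ‖ξ‖ ^ 2) := by
    rw [inner_neg_left, hN, hI]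
    field_simp
    ring
  rw [dMap, hden, hnum, norm_neg, dMap]
  generalize 1 + 2 * ⟪ξ, x⟫ + ‖x‖ ^ 2 * ‖ξ‖ ^ 2 = D at *
  match_scalars
  · field_simp
  · field_simp
    ring

lemma dMap_dMap_neg {ξ x : Eu n} (hξ : ‖ξ‖ < 1) (hx : ‖x‖ ≤ 1) : dMap ξ (dMap (-ξ) x) = x := by
  simpa using dMap_neg_dMap (ξ := -ξ) (by simpa using hξ) hx

lemma dMap_zero_right (ξ : Eu n) : dMap ξ 0 = ξ := by simp [dMap]

lemma dMap_zero_left (x : Eu n) : dMap 0 x = x := by simp [dMap]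

lemma inner_Refl {p : Eu n} (hp : ‖p‖ = 1) (x : Eu n) : ⟪p, Refl p x⟫ = -⟪p, x⟫ := by
  rw [Refl, inner_sub_right, real_inner_smul_right, real_inner_self_eq_norm_sq, hp]
  ring

lemma Refl_Refl {p : Eu n} (hp : ‖p‖ = 1) (x : Eu n) : Refl p (Refl p x) = x := by
  rw [Refl, inner_Refl hp, Refl]
  module

lemma norm_Refl {p : Eu n} (hp : ‖p‖ = 1) (x : Eu n) : ‖Refl p x‖ ^ 2 = ‖x‖ ^ 2 := by
  rw [Refl, norm_sub_sq_real, norm_smul, hp, real_inner_smul_right, real_inner_comm, mul_one,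
    Real.norm_eq_abs, sq_abs]
  ring

lemma isBallConformal_Refl {p : Eu n} (hp : ‖p‖ = 1) : IsBallConformal (Refl p) := by
  refine ⟨fun _ => 1, fun x _ => ⟨one_pos, by rw [norm_Refl hp, one_mul]⟩, fun x y _ _ => ?_⟩
  have : Refl p x - Refl p y = Refl p (x - y) := by
    simp only [Refl, inner_sub_right]
    module
  rw [this, norm_Refl hp, one_mul, one_mul]

lemma norm_smul_lt_one {r : ℝ} (hr : r ∈ Set.Ioo (-1 : ℝ) 1) {p : Eu n} (hp : ‖p‖ = 1) :
    ‖r • p‖ < 1 := by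
  rw [norm_smul, hp, mul_one, Real.norm_eq_abs, abs_lt]
  exact hr

lemma isBallConformal_tauMap {r : ℝ} (hr : r ∈ Set.Ioo (-1 : ℝ) 1) {p : Eu n} (hp : ‖p‖ = 1) :
    IsBallConformal (tauMap r p) :=
  (isBallConformal_dMap (norm_smul_lt_one hr hp)).comp ((isBallConformal_Refl hp).comp
    (isBallConformal_dMap (by rw [norm_neg]; exact norm_smul_lt_one hr hp)))

lemma dMap_neg_tauMap {r : ℝ} (hr : r ∈ Set.Ioo (-1 : ℝ) 1) {p : Eu n} (hp : ‖p‖ = 1) {x : Eu n}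
    (hx : ‖x‖ ≤ 1) : dMap (-(r • p)) (tauMap r p x) = Refl p (dMap (-(r • p)) x) :=
  dMap_neg_dMap (norm_smul_lt_one hr hp) ((isBallConformal_Refl hp).norm_le
    ((isBallConformal_dMap (by rw [norm_neg]; exact norm_smul_lt_one hr hp)).norm_le hx))

lemma tauMap_tauMap {r : ℝ} (hr : r ∈ Set.Ioo (-1 : ℝ) 1) {p : Eu n} (hp : ‖p‖ = 1) {x : Eu n}
    (hx : ‖x‖ ≤ 1) : tauMap r p (tauMap r p x) = x := by
  change dMap (r • p) (Refl p (dMap (-(r • p)) (tauMap r p x))) = x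
  rw [dMap_neg_tauMap hr hp hx, Refl_Refl hp, dMap_dMap_neg (norm_smul_lt_one hr hp) hx]

lemma tauMap_neg_neg (r : ℝ) (p : Eu n) : tauMap (-r) (-p) = tauMap r p := by
  have : Refl (-p) = Refl p := by
    funext x
    simp [Refl]
  simp [tauMap, this]

/-- A conformal map of the ball fixing the origin is orthogonal. -/
lemma IsBallConformal.exists_linearIsometryEquiv {f : Eu n → Eu n} (hf : IsBallConformal f)
    (h0 : f 0 = 0) : ∃ L : Eu n ≃ₗᵢ[ℝ] Eu n, ∀ x, ‖x‖ ≤ 1 → f x = L x := by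
  obtain ⟨l, h1, h2⟩ := hf
  have hl0 : l 0 = 1 := by
    have := (h1 0 (by simp)).2
    simpa [h0] using this.symm
  have hl : ∀ x, ‖x‖ ≤ 1 → l x = 1 ∧ ‖f x‖ ^ 2 = ‖x‖ ^ 2 := by
    intro x hx
    have h3 := h2 x 0 hx (by simp)
    rw [h0, sub_zero, sub_zero, hl0, mul_one] at h3
    have h4 := (h1 x hx).2
    have h5 : l x = 1 := by linarith
    rw [h5] at h3
    exact ⟨h5, by linarith⟩
  have hinner : ∀ x y, ‖x‖ ≤ 1 → ‖y‖ ≤ 1 → ⟪f x, f y⟫ = ⟪x, y⟫ := by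
    intro x y hx hy
    have h3 := h2 x y hx hy
    rw [(hl x hx).1, (hl y hy).1, norm_sub_sq_real, norm_sub_sq_real, (hl x hx).2,
      (hl y hy).2] at h3
    linarith
  let b := EuclideanSpace.basisFun (Fin (n + 1)) ℝ
  have hb : ∀ i, ‖b i‖ ≤ 1 := fun i => (b.norm_eq_one i).le
  have hon : Orthonormal ℝ (fun i => f (b i)) := by
    rw [orthonormal_iff_ite]
    intro i j
    rw [hinner _ _ (hb i) (hb j)]
    exact orthonormal_iff_ite.1 b.orthonormal i j
  let b' : OrthonormalBasis (Fin (n + 1)) ℝ (Eu n) :=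
    OrthonormalBasis.mk hon (hon.linearIndependent.span_eq_top_of_card_eq_finrank' (by simp)).ge
  have hb' : ∀ i, b' i = f (b i) := fun i => by simp [b']
  refine ⟨b.equiv b' (Equiv.refl _), fun x hx => ?_⟩
  refine InnerProductSpace.ext_inner_left_basis b'.toBasis fun i => ?_
  have h3 : (b.equiv b' (Equiv.refl _)) (b i) = b' i := by simp
  rw [OrthonormalBasis.coe_toBasis]
  conv_rhs => rw [← h3]
  rw [LinearIsometryEquiv.inner_map_map, hb', hinner _ _ (hb i) hx]

/-- Every conformal map of the ball is an orthogonal map composed with some `dMap η`. -/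
lemma IsBallConformal.exists_eq_dMap {f : Eu n → Eu n} (hf : IsBallConformal f) {b : Eu n}
    (hb : ‖b‖ < 1) (h0 : f b = 0) :
    ∃ L : Eu n ≃ₗᵢ[ℝ] Eu n, ∀ x, ‖x‖ ≤ 1 → f x = L (dMap (-b) x) := by
  obtain ⟨L, hL⟩ := (hf.comp (isBallConformal_dMap hb)).exists_linearIsometryEquiv
    (by rw [Function.comp_apply, dMap_zero_right, h0])
  refine ⟨L, fun x hx => ?_⟩
  rw [← hL _ ((isBallConformal_dMap (ξ := -b) (by rwa [norm_neg])).norm_le hx),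
    Function.comp_apply, dMap_dMap_neg hb hx]

/-- Displacement by `dMap η` of a point of the sphere, in the direction of `η`. -/
lemma inner_dMap_sub {η x : Eu n} (hη : ‖η‖ < 1) (hx : ‖x‖ = 1) :
    ⟪η, dMap η x⟫ - ⟪η, x⟫ =
      2 * (‖η‖ ^ 2 - ⟪η, x⟫ ^ 2) / (1 + 2 * ⟪η, x⟫ + ‖x‖ ^ 2 * ‖η‖ ^ 2) := by
  have hD := (dMap_denom_pos hη hx.le).ne'
  rw [dMap, real_inner_smul_right, inner_add_right, real_inner_smul_right,
    real_inner_smul_right, real_inner_self_eq_norm_sq]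
  rw [hx, one_pow, one_mul] at hD ⊢
  field_simp
  ring

lemma inner_le_inner_dMap {η x : Eu n} (hη : ‖η‖ < 1) (hx : ‖x‖ = 1) :
    ⟪η, x⟫ ≤ ⟪η, dMap η x⟫ := by
  rw [← sub_nonneg, inner_dMap_sub hη hx]
  have h := abs_real_inner_le_norm η x
  rw [hx, mul_one] at h
  refine div_nonneg ?_ (dMap_denom_pos hη hx.le).le
  have := sq_le_sq.2 (h.trans (le_abs_self ‖η‖))
  linarith

lemma eq_or_eq_neg_of_inner_dMap_eq {η x : Eu n} (hη : ‖η‖ < 1) (h0 : η ≠ 0) (hx : ‖x‖ = 1)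
    (h : ⟪η, dMap η x⟫ = ⟪η, x⟫) : x = ‖η‖⁻¹ • η ∨ x = -(‖η‖⁻¹ • η) := by
  have h1 := inner_dMap_sub hη hx
  rw [h, sub_self, eq_comm, div_eq_zero_iff, or_iff_left (dMap_denom_pos hη hx.le).ne'] at h1
  have hn : ‖η‖ ≠ 0 := norm_ne_zero_iff.2 h0
  have h2 : ⟪η, x⟫ ^ 2 = ‖η‖ ^ 2 := by linarith
  have h3 : x = (⟪η, x⟫ / ‖η‖ ^ 2) • η := by
    rw [← sub_eq_zero, ← norm_eq_zero, ← sq_eq_zero_iff, norm_sub_sq_real, hx, norm_smul,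
      real_inner_smul_right, real_inner_comm, mul_pow, Real.norm_eq_abs, sq_abs]
    field_simp
    rw [real_inner_comm, h2]
    ring
  rcases sq_eq_sq_iff_eq_or_eq_neg.1 h2 with h4 | h4
  · left
    rw [h4] at h3
    rw [h3]
    congr 1
    field_simp
  · right
    rw [h4] at h3
    rw [← neg_smul, h3]
    congr 1
    field_simp

end MoebiusMaps

section CapMeasure

variable {n : ℕ}

lemma measurable_dMap (ξ : Eu n) : Measurable (dMap ξ) := by
  unfold dMap
  fun_prop

lemma measurable_tauMap (r : ℝ) (p : Eu n) : Measurable (tauMap r p) := by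
  have : Measurable (Refl p) := by
    unfold Refl
    fun_prop
  exact (measurable_dMap _).comp (this.comp (measurable_dMap _))

lemma cap_eq {r : ℝ} (hr : r ∈ Set.Ioo (-1 : ℝ) 1) {p : Eu n} (hp : ‖p‖ = 1) :
    cap n r p = {x | ‖x‖ = 1 ∧ 0 < ⟪p, dMap (-(r • p)) x⟫} := by
  have hrp := norm_smul_lt_one hr hp
  ext x
  simp only [cap, sphSet, mem_image, mem_ofPred_eq, mem_sphere_zero_iff_norm]
  constructor
  · rintro ⟨y, ⟨hy, hpy⟩, rfl⟩
    exact ⟨(isBallConformal_dMap hrp).norm_eq_one hy, by rwa [dMap_neg_dMap hrp hy.le]⟩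
  · rintro ⟨hx, hpx⟩
    exact ⟨_, ⟨(isBallConformal_dMap (by rwa [norm_neg])).norm_eq_one hx, hpx⟩,
      dMap_dMap_neg hrp hx.le⟩

lemma measurableSet_cap {r : ℝ} (hr : r ∈ Set.Ioo (-1 : ℝ) 1) {p : Eu n} (hp : ‖p‖ = 1) :
    MeasurableSet (cap n r p) := by
  rw [cap_eq hr hp]
  have h : Measurable fun x : Eu n => (⟪p, dMap (-(r • p)) x⟫ : ℝ) :=
    (measurable_dMap _).const_inner
  exact (measurableSet_eq_fun measurable_norm measurable_const).inter
    (measurableSet_lt measurable_const h)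

lemma neg_mem_Ioo_neg_one_one {r : ℝ} (hr : r ∈ Set.Ioo (-1 : ℝ) 1) :
    -r ∈ Set.Ioo (-1 : ℝ) 1 :=
  ⟨by linarith [hr.2], by linarith [hr.1]⟩

lemma tauMap_mem_cap_iff {r : ℝ} (hr : r ∈ Set.Ioo (-1 : ℝ) 1) {p : Eu n} (hp : ‖p‖ = 1)
    {x : Eu n} (hx : ‖x‖ = 1) : tauMap r p x ∈ cap n r p ↔ x ∈ cap n (-r) (-p) := by
  rw [cap_eq hr hp, cap_eq (neg_mem_Ioo_neg_one_one hr) (by rwa [norm_neg]), mem_ofPred_eq,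
    mem_ofPred_eq, dMap_neg_tauMap hr hp hx.le, inner_Refl hp, neg_smul_neg, inner_neg_left]
  simp [hx, (isBallConformal_tauMap hr hp).norm_eq_one hx]

lemma tauMap_mem_cap_neg_iff {r : ℝ} (hr : r ∈ Set.Ioo (-1 : ℝ) 1) {p : Eu n} (hp : ‖p‖ = 1)
    {x : Eu n} (hx : ‖x‖ = 1) : tauMap r p x ∈ cap n (-r) (-p) ↔ x ∈ cap n r p := by
  rw [← tauMap_mem_cap_iff hr hp ((isBallConformal_tauMap hr hp).norm_eq_one hx),
    tauMap_tauMap hr hp hx.le]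

lemma sphMeasure_ae_norm_eq_one : ∀ᵐ x ∂(sphMeasure n), ‖x‖ = 1 := by
  rw [sphMeasure, ae_map_iff measurable_subtype_coe.aemeasurable
    (measurableSet_eq_fun measurable_norm measurable_const)]
  exact Eventually.of_forall fun x => mem_sphere_zero_iff_norm.1 x.2

lemma sphMeasure_singleton (hn : 1 ≤ n) (x : Eu n) : sphMeasure n {x} = 0 := by
  rw [sphMeasure, Measure.map_apply measurable_subtype_coe (measurableSet_singleton x),
    Measure.toSphere_apply' _ (measurable_subtype_coe (measurableSet_singleton x))]
  refine mul_eq_zero_of_right _ (measure_mono_null (t := (Submodule.span ℝ {x} : Set (Eu n))) ?_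
    (Measure.addHaar_submodule _ _ fun h => ?_))
  · rintro _ ⟨c, -, _, ⟨y, hy, rfl⟩, rfl⟩
    rw [mem_preimage, mem_singleton_iff] at hy
    rw [hy]
    exact Submodule.smul_mem _ _ (Submodule.mem_span_singleton_self x)
  · have h1 := finrank_span_le_card (R := ℝ) ({x} : Set (Eu n))
    rw [h, Set.toFinset_singleton, Finset.card_singleton, finrank_top,
      finrank_euclideanSpace_fin] at h1
    omega

lemma confMeasure_ae_norm_eq_one (w : Eu n → ℝ) : ∀ᵐ x ∂(confMeasure n w), ‖x‖ = 1 :=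
  (withDensity_absolutelyContinuous _ _).ae_le sphMeasure_ae_norm_eq_one

lemma confMeasure_singleton (hn : 1 ≤ n) (w : Eu n → ℝ) (x : Eu n) :
    confMeasure n w {x} = 0 :=
  withDensity_absolutelyContinuous _ _ (sphMeasure_singleton hn x)

variable {w : Eu n → ℝ} {r : ℝ} {p : Eu n}

lemma map_tauMap_confMeasure_singleton (hn : 1 ≤ n) (hr : r ∈ Set.Ioo (-1 : ℝ) 1)
    (hp : ‖p‖ = 1) (x : Eu n) : Measure.map (tauMap r p) (confMeasure n w) {x} = 0 := by
  rw [Measure.map_apply (measurable_tauMap r p) (measurableSet_singleton x)]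
  refine measure_mono_null (t := {tauMap r p x} ∪ {y | ¬ ‖y‖ = 1}) (fun y hy => ?_)
    (measure_union_null (confMeasure_singleton hn w _) (confMeasure_ae_norm_eq_one w))
  by_cases h : ‖y‖ = 1
  · left
    rw [mem_preimage, mem_singleton_iff] at hy
    rw [mem_singleton_iff, ← hy, tauMap_tauMap hr hp h.le]
  · right
    exact h

lemma capMeasure_singleton (hn : 1 ≤ n) (hr : r ∈ Set.Ioo (-1 : ℝ) 1) (hp : ‖p‖ = 1)
    (x : Eu n) : capMeasure n w r p {x} = 0 := by
  refine Measure.restrict_le_self.absolutelyContinuous ?_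
  rw [Measure.add_apply, confMeasure_singleton hn, map_tauMap_confMeasure_singleton hn hr hp,
    add_zero]

lemma capMeasure_ae_norm_eq_one (hr : r ∈ Set.Ioo (-1 : ℝ) 1) (hp : ‖p‖ = 1) :
    ∀ᵐ x ∂(capMeasure n w r p), ‖x‖ = 1 := by
  filter_upwards [ae_restrict_mem (measurableSet_cap hr hp)] with x hx
  rw [cap_eq hr hp] at hx
  exact hx.1

lemma isFiniteMeasure_capMeasure (h : confMeasure n w Set.univ = 1) :
    IsFiniteMeasure (capMeasure n w r p) := by
  have : IsFiniteMeasure (confMeasure n w) := ⟨by rw [h]; exact ENNReal.one_lt_top⟩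
  unfold capMeasure
  infer_instance

/-- The conformal reflection carries the measure of a cap to that of the opposite cap. -/
lemma map_tauMap_capMeasure (hr : r ∈ Set.Ioo (-1 : ℝ) 1) (hp : ‖p‖ = 1) :
    Measure.map (tauMap r p) (capMeasure n w r p) = capMeasure n w (-r) (-p) := by
  have hτ := measurable_tauMap r p
  have hm := measurableSet_cap hr hp
  have hm' := measurableSet_cap (neg_mem_Ioo_neg_one_one hr) (p := -p) (by rwa [norm_neg])
  ext s hs
  rw [Measure.map_apply hτ hs, capMeasure, capMeasure, tauMap_neg_neg,
    Measure.restrict_apply (hτ hs), Measure.restrict_apply hs, Measure.add_apply,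
    Measure.add_apply, Measure.map_apply hτ ((hτ hs).inter hm),
    Measure.map_apply hτ (hs.inter hm'), add_comm]
  congr 1
  · refine measure_congr (eventuallyEq_set.2 ?_)
    filter_upwards [confMeasure_ae_norm_eq_one w] with x hx
    simp only [mem_preimage, mem_inter_iff, tauMap_mem_cap_iff hr hp hx,
      tauMap_tauMap hr hp hx.le]
  · refine measure_congr (eventuallyEq_set.2 ?_)
    filter_upwards [confMeasure_ae_norm_eq_one w] with x hx
    simp only [mem_preimage, mem_inter_iff, tauMap_mem_cap_neg_iff hr hp hx]

/-- Uniqueness of the renormalization point of an atomless measure on the sphere. -/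
lemma eq_zero_of_integral_inner_dMap_eq_zero {μ : Measure (Eu n)} [IsFiniteMeasure μ]
    (hμ0 : μ ≠ 0) {ξ η : Eu n} (hξ : ‖ξ‖ < 1) (hη : ‖η‖ < 1) (hμ : ∀ᵐ x ∂μ, ‖x‖ = 1)
    (hat : ∀ x, μ {x} = 0) (h1 : ∫ x, ⟪η, dMap ξ x⟫ ∂μ = 0)
    (h2 : ∫ x, ⟪η, dMap η (dMap ξ x)⟫ ∂μ = 0) : η = 0 := by
  by_contra h0
  have hcξ := isBallConformal_dMap hξ
  have hcη := isBallConformal_dMap hη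
  have hint : ∀ f : Eu n → Eu n, Measurable f → (∀ x, ‖x‖ = 1 → ‖f x‖ = 1) →
      Integrable (fun x => (⟪η, f x⟫ : ℝ)) μ := by
    intro f hf hf1
    refine Integrable.of_bound hf.const_inner.aestronglyMeasurable ‖η‖ ?_
    filter_upwards [hμ] with x hx
    simpa [hf1 x hx] using norm_inner_le_norm (𝕜 := ℝ) η (f x)
  have hi1 := hint _ (measurable_dMap ξ) fun x hx => hcξ.norm_eq_one hx
  have hi2 : Integrable (fun x => (⟪η, dMap η (dMap ξ x)⟫ : ℝ)) μ :=
    hint _ ((measurable_dMap η).comp (measurable_dMap ξ))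
    fun x hx => hcη.norm_eq_one (hcξ.norm_eq_one hx)
  have h3 : ∫ x, (⟪η, dMap η (dMap ξ x)⟫ - ⟪η, dMap ξ x⟫ : ℝ) ∂μ = 0 := by
    rw [integral_sub hi2 hi1, h1, h2, sub_zero]
  rw [integral_eq_zero_iff_of_nonneg_ae ?_
    (show Integrable (fun x => (⟪η, dMap η (dMap ξ x)⟫ - ⟪η, dMap ξ x⟫ : ℝ)) μ
      from hi2.sub hi1)] at h3
  · have h4 : ∀ᵐ x ∂μ, x ∈ ({dMap (-ξ) (‖η‖⁻¹ • η)} ∪ {dMap (-ξ) (-(‖η‖⁻¹ • η))} : Set (Eu n)) := by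
      filter_upwards [h3, hμ] with x hx hx1
      rcases eq_or_eq_neg_of_inner_dMap_eq hη h0 (hcξ.norm_eq_one hx1) (sub_eq_zero.1 hx) with h | h
      · left
        rw [mem_singleton_iff, ← h, dMap_neg_dMap hξ hx1.le]
      · right
        rw [mem_singleton_iff, ← h, dMap_neg_dMap hξ hx1.le]
    have h5 : ∀ᵐ x ∂μ, x ∉ ({dMap (-ξ) (‖η‖⁻¹ • η)} ∪ {dMap (-ξ) (-(‖η‖⁻¹ • η))} : Set (Eu n)) :=
      measure_eq_zero_iff_ae_notMem.1 (measure_union_null (hat _) (hat _))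
    have h6 : ∀ᵐ x ∂μ, False := by
      filter_upwards [h4, h5] with x ha hb using hb ha
    exact hμ0 (ae_eq_bot.1 (Filter.eventually_false_iff_eq_bot.1 h6))
  · filter_upwards [hμ] with x hx
    exact sub_nonneg.2 (inner_le_inner_dMap hη (hcξ.norm_eq_one hx))

lemma IsMaxDir.ne_zero (hn : 1 ≤ n) {ν : Measure (Eu n)} {s : Eu n} (h : IsMaxDir ν s) :
    ν ≠ 0 := by
  rintro rfl
  have hQ : ∀ t : Eu n, Qform (0 : Measure (Eu n)) t = 0 := fun t => by simp [Qform]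
  have hm : maxEig n (0 : Measure (Eu n)) = 0 := by
    have : {q : ℝ | ∃ t : Eu n, ‖t‖ = 1 ∧ q = Qform (0 : Measure (Eu n)) t} = {0} := by
      ext q
      simp only [hQ, mem_ofPred_eq, mem_singleton_iff]
      exact ⟨fun ⟨_, _, hq⟩ => hq, fun hq => ⟨s, h.1, hq⟩⟩
    rw [maxEig, this, csSup_singleton]
  have hspan : Submodule.span ℝ {s} = ⊤ := by
    refine eq_top_iff.2 fun t _ => ?_
    obtain ⟨c, hc⟩ := (h.2 t).1 (by rw [hQ, hm, zero_mul])
    exact Submodule.mem_span_singleton.2 ⟨c, hc.symm⟩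
  have h1 := finrank_span_le_card (R := ℝ) ({s} : Set (Eu n))
  rw [hspan, Set.toFinset_singleton, Finset.card_singleton, finrank_top,
      finrank_euclideanSpace_fin] at h1
  omega

lemma Qform_map_linearIsometryEquiv (ν : Measure (Eu n)) (L : Eu n ≃ₗᵢ[ℝ] Eu n) (s : Eu n) :
    Qform (Measure.map L ν) s = Qform ν (L.symm s) := by
  rw [Qform, L.toHomeomorph.measurableEmbedding.integral_map (f := L)]
  refine integral_congr_ae (Eventually.of_forall fun x => ?_)
  beta_reduce
  rw [← L.inner_map_map (L.symm s) x, L.apply_symm_apply]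

lemma IsMaxDir.map_linearIsometryEquiv {ν : Measure (Eu n)} {s : Eu n} (h : IsMaxDir ν s)
    (L : Eu n ≃ₗᵢ[ℝ] Eu n) : IsMaxDir (Measure.map L ν) (L s) := by
  have hm : maxEig n (Measure.map L ν) = maxEig n ν := by
    unfold maxEig
    congr 1
    ext q
    simp only [Qform_map_linearIsometryEquiv, mem_ofPred_eq]
    exact ⟨fun ⟨t, ht, hq⟩ => ⟨L.symm t, by rwa [L.symm.norm_map], hq⟩,
      fun ⟨t, ht, hq⟩ => ⟨L t, by rwa [L.norm_map], by rwa [L.symm_apply_apply]⟩⟩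
  refine ⟨by rw [L.norm_map, h.1], fun t => ?_⟩
  rw [hm, Qform_map_linearIsometryEquiv, ← L.symm.norm_map t, h.2]
  refine exists_congr fun c => ?_
  rw [← L.map_smul, L.symm_apply_eq]

lemma IsMaxDir.eq_or_eq_neg {ν : Measure (Eu n)} {s t : Eu n} (hs : IsMaxDir ν s)
    (ht : IsMaxDir ν t) : t = s ∨ t = -s := by
  obtain ⟨c, hc⟩ := (hs.2 t).1 ((ht.2 t).2 ⟨1, (one_smul ℝ t).symm⟩)
  have h1 : |c| = 1 := by
    have := ht.1
    rwa [hc, norm_smul, hs.1, mul_one, Real.norm_eq_abs] at this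
  rcases eq_or_eq_neg_of_abs_eq h1 with h | h
  · left
    rw [hc, h, one_smul]
  · right
    rw [hc, h, neg_one_smul]

end CapMeasure

/-- If the renormalized measures `ν_a` and `ν_{a*}` are simple, with maximal
directions `s₀` and `s₁`, then `R_a = d_{ξ*} ∘ τ_a ∘ d_{-ξ}` agrees on the closed unit ball with
an orthogonal transformation `L` of `ℝ^{n+1}`, and `[s₁] = R_a [s₀]`. -/
theorem maximal_direction_of_symmetric_cap (n : ℕ) (hn : 2 ≤ n)
    (w : Eu n → ℝ) (hw : IsConformalFactor n w) (hvol : confMeasure n w Set.univ = 1)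
    (r : ℝ) (hr : r ∈ Set.Ioo (-1 : ℝ) 1) (p : Eu n) (hp : p ∈ sphSet n)
    (ξ ξs : Eu n) (hξ : ‖ξ‖ < 1) (hξs : ‖ξs‖ < 1)
    (hren : Renormalizes ξ (capMeasure n w r p))
    (hrens : Renormalizes ξs (capMeasure n w (-r) (-p)))
    (s₀ s₁ : Eu n)
    (hs₀ : IsMaxDir (Measure.map (dMap ξ) (capMeasure n w r p)) s₀)
    (hs₁ : IsMaxDir (Measure.map (dMap ξs) (capMeasure n w (-r) (-p))) s₁) :
    ∃ L : Eu n ≃ₗᵢ[ℝ] Eu n,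
      (∀ x : Eu n, ‖x‖ ≤ 1 → dMap ξs (tauMap r p (dMap (-ξ) x)) = L x) ∧
      (s₁ = L s₀ ∨ s₁ = -(L s₀)) := by
  have hp1 : ‖p‖ = 1 := mem_sphere_zero_iff_norm.1 hp
  have hn1 : 1 ≤ n := by omega
  have hfin : IsFiniteMeasure (capMeasure n w r p) := isFiniteMeasure_capMeasure hvol
  have hμ := capMeasure_ae_norm_eq_one (w := w) hr hp1
  have hτ := measurable_tauMap r p
  have hcτ := isBallConformal_tauMap hr hp1
  have hnξ : ‖-ξ‖ < 1 := by rwa [norm_neg]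
  have hnξs : ‖-ξs‖ < 1 := by rwa [norm_neg]
  have hF : IsBallConformal (dMap ξs ∘ tauMap r p ∘ dMap (-ξ)) :=
    (isBallConformal_dMap hξs).comp (hcτ.comp (isBallConformal_dMap hnξ))
  have hb : ‖dMap ξ (tauMap r p (-ξs))‖ < 1 :=
    (isBallConformal_dMap hξ).norm_lt (hcτ.norm_lt hnξs)
  obtain ⟨L, hL⟩ := hF.exists_eq_dMap hb (by
    simp only [Function.comp_apply]
    rw [dMap_neg_dMap hξ (hcτ.norm_lt hnξs).le, tauMap_tauMap hr hp1 hnξs.le]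
    simpa [dMap_zero_right] using dMap_dMap_neg hξs (x := 0) (by simp))
  generalize dMap ξ (tauMap r p (-ξs)) = b at hb hL
  have hη : ‖-b‖ < 1 := by rwa [norm_neg]
  generalize -b = η at hη hL
  have hLae : ∀ᵐ x ∂(capMeasure n w r p), dMap ξs (tauMap r p x) = L (dMap η (dMap ξ x)) := by
    filter_upwards [hμ] with x hx
    rw [← hL _ ((isBallConformal_dMap hξ).norm_le hx.le)]
    simp only [Function.comp_apply, dMap_neg_dMap hξ hx.le]
  have hμ0 : capMeasure n w r p ≠ 0 := by
    intro h
    exact hs₀.ne_zero hn1 (by rw [h, Measure.map_zero])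
  have hη0 : η = 0 := by
    by_contra h0
    have hne : ‖η‖ ≠ 0 := norm_ne_zero_iff.2 h0
    have he : ‖‖η‖⁻¹ • η‖ = 1 := norm_smul_inv_norm h0
    have h1 := hren _ (mem_sphere_zero_iff_norm.2 he)
    have h2 := hrens (L (‖η‖⁻¹ • η)) (mem_sphere_zero_iff_norm.2 (by rw [L.norm_map, he]))
    have hX : Measurable fun x => Xfun (L (‖η‖⁻¹ • η)) (dMap ξs x) :=
      (measurable_dMap ξs).const_inner
    rw [← map_tauMap_capMeasure hr hp1,
      integral_map hτ.aemeasurable hX.aestronglyMeasurable] at h2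
    refine h0 (eq_zero_of_integral_inner_dMap_eq_zero hμ0 hξ hη hμ
      (capMeasure_singleton hn1 hr hp1) ?_ ?_)
    · simp only [Xfun, real_inner_smul_left] at h1
      rw [integral_const_mul] at h1
      exact (mul_eq_zero.1 h1).resolve_left (inv_ne_zero hne)
    · rw [integral_congr_ae (g := fun x => ‖η‖⁻¹ * ⟪η, dMap η (dMap ξ x)⟫) (by
        filter_upwards [hLae] with x hx
        rw [hx, Xfun, L.inner_map_map, real_inner_smul_left]), integral_const_mul] at h2
      exact (mul_eq_zero.1 h2).resolve_left (inv_ne_zero hne)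
  subst hη0
  simp only [dMap_zero_left] at hL hLae
  refine ⟨L, fun x hx => hL x hx, IsMaxDir.eq_or_eq_neg (hs₀.map_linearIsometryEquiv L) ?_⟩
  convert hs₁ using 1
  rw [← map_tauMap_capMeasure hr hp1, Measure.map_map (measurable_dMap ξs) hτ,
    Measure.map_map L.continuous.measurable (measurable_dMap ξ)]
  exact Measure.map_congr (hLae.mono fun x hx => hx.symm)

end
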